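/- For every complex number d with Re(d) > 0, there holds ₄F₃(3, 1, 2, d+1; 5/2, 5, d; 1) = 9π²/16 + 3(4/d − 1). -/

import Mathlib

open scoped Nat

/-- Pochhammer symbol `(x)_k = x (x+1) ⋯ (x+k-1)` for a complex number `x`. -/
noncomputable def poch (x : ℂ) (k : ℕ) : ℂ := (ascPochhammer ℂ k).eval x

/-- The generalized hypergeometric series
`ₚF_q(a₁,…,aₚ; b₁,…,b_q; z) = ∑ₖ ((a₁)ₖ ⋯ (aₚ)ₖ)/((b₁)ₖ ⋯ (b_q)ₖ) · zᵏ/k!`. -/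
noncomputable def hyp (a b : List ℂ) (z : ℂ) : ℂ :=
  ∑' k : ℕ, ((a.map (poch · k)).prod / (b.map (poch · k)).prod) * z ^ k / (k ! : ℂ)

open Filter Topology Finset

/-- The ratio `4 ^ n / (2n choose n)`. -/
noncomputable def invCentralBinom (n : ℕ) : ℝ := 4 ^ n / (n.centralBinom : ℝ)

theorem invCentralBinom_pos (n : ℕ) : 0 < invCentralBinom n :=
  div_pos (by positivity) (by exact_mod_cast n.centralBinom_pos)

theorem invCentralBinom_zero : invCentralBinom 0 = 1 := by simp [invCentralBinom]

theorem invCentralBinom_succ (n : ℕ) :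
    invCentralBinom (n + 1) = invCentralBinom n * ((2 * n + 2) / (2 * n + 1)) := by
  have h : ((n : ℝ) + 1) * ((n + 1).centralBinom : ℝ) = 2 * (2 * n + 1) * n.centralBinom := by
    exact_mod_cast Nat.succ_mul_centralBinom_succ n
  have h₀ : (n.centralBinom : ℝ) ≠ 0 := by exact_mod_cast n.centralBinom_ne_zero
  have h₁ : ((n + 1).centralBinom : ℝ) ≠ 0 := by exact_mod_cast (n + 1).centralBinom_ne_zero
  unfold invCentralBinom
  field_simp
  rw [pow_succ]
  linear_combination -2 * 4 ^ n * h

theorem invCentralBinom_sq_le (n : ℕ) : invCentralBinom (n + 1) ^ 2 ≤ 4 * (n + 1) := by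
  induction n with
  | zero => norm_num [invCentralBinom_succ, invCentralBinom_zero]
  | succ n ih =>
    rw [invCentralBinom_succ, mul_pow]
    refine (mul_le_mul_of_nonneg_right ih (by positivity)).trans ?_
    push_cast
    rw [div_pow, mul_div_assoc', div_le_iff₀ (by positivity)]
    nlinarith [(Nat.cast_nonneg n : (0 : ℝ) ≤ n)]

theorem tendsto_invCentralBinom_div :
    Tendsto (fun n : ℕ => invCentralBinom (n + 1) / (n + 1)) atTop (𝓝 0) := by
  have h : Tendsto (fun n : ℕ => √(4 * (1 / ((n : ℝ) + 1)))) atTop (𝓝 0) := by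
    simpa using (tendsto_one_div_add_atTop_nhds_zero_nat (𝕜 := ℝ)).const_mul 4 |>.sqrt
  refine squeeze_zero (fun n => ?_) (fun n => ?_) h
  · have := invCentralBinom_pos (n + 1)
    positivity
  · apply Real.le_sqrt_of_sq_le
    rw [div_pow, div_le_iff₀ (by positivity)]
    refine (invCentralBinom_sq_le n).trans (le_of_eq ?_)
    field_simp

/-- The moment `∫ x cos²ⁿ x` over `[0, π/2]`. -/
noncomputable def cosMoment (n : ℕ) : ℝ :=
  ∫ x in (0 : ℝ)..(Real.pi / 2), x * Real.cos x ^ (2 * n)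

theorem cosMoment_zero : cosMoment 0 = Real.pi ^ 2 / 8 := by
  simp [cosMoment]
  ring

theorem cosMoment_succ (n : ℕ) :
    (2 * n + 2) * (2 * n + 1) * cosMoment n - (2 * n + 2) ^ 2 * cosMoment (n + 1) = 1 := by
  have hderiv : ∀ x ∈ Set.uIcc 0 (Real.pi / 2), HasDerivAt
      (fun x : ℝ => -(2 * n + 2) * (x * (Real.cos x ^ (2 * n + 1) * Real.sin x))
        - Real.cos x ^ (2 * n + 2))
      ((2 * n + 2) * (2 * n + 1) * (x * Real.cos x ^ (2 * n))
        - (2 * n + 2) ^ 2 * (x * Real.cos x ^ (2 * (n + 1)))) x := by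
    intro x _
    have h := (((hasDerivAt_id x).mul (((Real.hasDerivAt_cos x).pow (2 * n + 1)).mul
      (Real.hasDerivAt_sin x))).const_mul (-(2 * (n : ℝ) + 2))).sub
      ((Real.hasDerivAt_cos x).pow (2 * n + 2))
    refine h.congr_deriv ?_
    simp only [id, Pi.mul_apply, Pi.pow_apply, Nat.add_sub_cancel,
      show 2 * n + 2 - 1 = 2 * n + 1 by omega]
    push_cast
    have hs : Real.sin x * Real.sin x = 1 - Real.cos x ^ 2 := by
      rw [← Real.sin_sq]; ring
    linear_combination (2 * (n : ℝ) + 2) * (2 * n + 1) * x * Real.cos x ^ (2 * n) * hs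
  have hint := intervalIntegral.integral_eq_sub_of_hasDerivAt hderiv
    (Continuous.intervalIntegrable (by fun_prop) _ _)
  rw [intervalIntegral.integral_sub (Continuous.intervalIntegrable (by fun_prop) _ _)
    (Continuous.intervalIntegrable (by fun_prop) _ _),
    intervalIntegral.integral_const_mul, intervalIntegral.integral_const_mul] at hint
  simpa [cosMoment] using hint

theorem cosMoment_nonneg (n : ℕ) : 0 ≤ cosMoment n :=
  intervalIntegral.integral_nonneg (by positivity) fun x hx =>
    mul_nonneg hx.1 ((even_two_mul n).pow_nonneg _)

theorem cosMoment_le (n : ℕ) : cosMoment n ≤ Real.pi / 2 * (1 / (2 * n + 1)) := by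
  have hval : ∫ x in (0 : ℝ)..(Real.pi / 2), Real.sin x * Real.cos x ^ (2 * n) =
      1 / (2 * n + 1) := by
    have hderiv : ∀ x ∈ Set.uIcc 0 (Real.pi / 2), HasDerivAt
        (fun x : ℝ => -(Real.cos x ^ (2 * n + 1)) / (2 * n + 1))
        (Real.sin x * Real.cos x ^ (2 * n)) x := by
      intro x _
      refine (((Real.hasDerivAt_cos x).pow (2 * n + 1)).neg.div_const _).congr_deriv ?_
      push_cast
      field_simp
    rw [intervalIntegral.integral_eq_sub_of_hasDerivAt hderiv
      (Continuous.intervalIntegrable (by fun_prop) _ _)]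
    simp [neg_div]
  rw [← hval, ← intervalIntegral.integral_const_mul]
  refine intervalIntegral.integral_mono_on (by positivity)
    (Continuous.intervalIntegrable (by fun_prop) _ _)
    (Continuous.intervalIntegrable (by fun_prop) _ _) fun x hx => ?_
  rw [← mul_assoc]
  refine mul_le_mul_of_nonneg_right ?_ ((even_two_mul n).pow_nonneg _)
  have h := Real.mul_le_sin hx.1 hx.2
  calc x = Real.pi / 2 * (2 / Real.pi * x) := by field_simp
    _ ≤ _ := mul_le_mul_of_nonneg_left h (by positivity)

theorem tendsto_invCentralBinom_mul_cosMoment :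
    Tendsto (fun n : ℕ => invCentralBinom (n + 1) * cosMoment (n + 1)) atTop (𝓝 0) := by
  have h := tendsto_invCentralBinom_div.const_mul (Real.pi / 2)
  rw [mul_zero] at h
  refine squeeze_zero (fun n => ?_) (fun n => ?_) h
  · exact mul_nonneg (invCentralBinom_pos _).le (cosMoment_nonneg _)
  · have hw := invCentralBinom_pos (n + 1)
    refine (mul_le_mul_of_nonneg_left (cosMoment_le (n + 1)) hw.le).trans ?_
    have : 1 / (2 * ((n + 1 : ℕ) : ℝ) + 1) ≤ 1 / (n + 1) := by
      apply one_div_le_one_div_of_le (by positivity)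
      push_cast
      linarith [(Nat.cast_nonneg n : (0 : ℝ) ≤ n)]
    calc _ ≤ invCentralBinom (n + 1) * (Real.pi / 2 * (1 / (n + 1))) := by gcongr
      _ = _ := by ring

theorem invCentralBinom_div_sq (n : ℕ) :
    invCentralBinom (n + 1) / (n + 1) ^ 2 =
      4 * (invCentralBinom n * cosMoment n - invCentralBinom (n + 1) * cosMoment (n + 1)) := by
  have h := cosMoment_succ n
  rw [invCentralBinom_succ]
  field_simp
  linear_combination -2 * invCentralBinom n * h

theorem hasSum_of_nonneg_of_telescope {f g : ℕ → ℝ} (hf : ∀ n, 0 ≤ f n)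
    (hfg : ∀ n, f n = g n - g (n + 1)) (hg : Tendsto g atTop (𝓝 0)) : HasSum f (g 0) := by
  rw [hasSum_iff_tendsto_nat_of_nonneg hf]
  simp_rw [hfg, sum_range_sub']
  simpa using hg.const_sub (g 0)

/-- `9 * invCentralBinom (k + 2) / ((k + 2) (k + 3) (k + 4))`. -/
noncomputable def watsonTerm (k : ℕ) : ℝ :=
  9 * invCentralBinom (k + 2) / ((k + 2) * (k + 3) * (k + 4))

theorem watsonTerm_nonneg (k : ℕ) : 0 ≤ watsonTerm k := by
  have := invCentralBinom_pos (k + 2)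
  unfold watsonTerm
  positivity

theorem tendsto_invCentralBinom_mul_of_le {r : ℕ → ℝ} (hr₀ : ∀ k, 0 ≤ r k)
    (hr : ∀ k : ℕ, r k ≤ 2 / (k + 2)) :
    Tendsto (fun k : ℕ => invCentralBinom (k + 2) * r k) atTop (𝓝 0) := by
  have h := ((tendsto_add_atTop_iff_nat 1).2 tendsto_invCentralBinom_div).const_mul 2
  rw [mul_zero] at h
  refine squeeze_zero (fun k => mul_nonneg (invCentralBinom_pos _).le (hr₀ k))
    (fun k => (mul_le_mul_of_nonneg_left (hr k) (invCentralBinom_pos _).le).trans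
      (le_of_eq ?_)) h
  push_cast
  rw [show (k : ℝ) + 1 + 1 = k + 2 by ring]
  ring

theorem hasSum_watsonTerm : HasSum watsonTerm (9 * Real.pi ^ 2 / 16 - 3) := by
  have hr := tendsto_invCentralBinom_mul_of_le
    (r := fun k => (2 * k + 3) * (k + 1) / (8 * (k + 2) ^ 2 * (k + 3)))
    (fun k => by positivity) (fun k => by
      rw [div_le_div_iff₀ (by positivity) (by positivity)]
      have : (0 : ℝ) ≤ k := k.cast_nonneg
      ring_nf
      nlinarith [pow_nonneg this 2, pow_nonneg this 3])
  have hK := (tendsto_invCentralBinom_mul_cosMoment).const_mul (9 / 2)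
  have hg := hK.sub (hr.const_mul 9)
  rw [mul_zero, mul_zero, sub_zero] at hg
  have h := hasSum_of_nonneg_of_telescope watsonTerm_nonneg (fun k => ?_) hg
  · convert h using 1
    have h₀ := invCentralBinom_div_sq 0
    norm_num [invCentralBinom_succ, invCentralBinom_zero, cosMoment_zero] at h₀ ⊢
    linarith
  · have hk := invCentralBinom_div_sq (k + 1)
    have hw : invCentralBinom (k + 1 + 2) = _ := invCentralBinom_succ (k + 2)
    simp only [show k + 1 + 1 = k + 2 from rfl] at hk ⊢
    have e : watsonTerm k = 9 / 8 * (invCentralBinom (k + 2) / ((k + 1 : ℕ) + 1 : ℝ) ^ 2) -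
        9 * (invCentralBinom (k + 2) * ((2 * k + 3) * (k + 1) / (8 * (k + 2) ^ 2 * (k + 3))) -
          invCentralBinom (k + 1 + 2) *
            ((2 * (k + 1 : ℕ) + 3) * ((k + 1 : ℕ) + 1) /
              (8 * ((k + 1 : ℕ) + 2) ^ 2 * ((k + 1 : ℕ) + 3)))) := by
      rw [hw, watsonTerm]
      push_cast
      rw [show (k : ℝ) + 1 + 1 = k + 2 by ring, show (k : ℝ) + 1 + 2 = k + 3 by ring,
        show (k : ℝ) + 1 + 3 = k + 4 by ring]
      field_simp
      ring
    rw [e, hk]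
    ring

theorem hasSum_mul_watsonTerm : HasSum (fun k : ℕ => k * watsonTerm k) 12 := by
  have hr := tendsto_invCentralBinom_mul_of_le
    (r := fun k => (2 * k + 3) / ((k + 2) * (k + 3)))
    (fun k => by positivity) (fun k => by
      rw [div_le_div_iff₀ (by positivity) (by positivity)]
      have : (0 : ℝ) ≤ k := k.cast_nonneg
      nlinarith [pow_nonneg this 2])
  have hg := hr.const_mul 9
  rw [mul_zero] at hg
  have h := hasSum_of_nonneg_of_telescope
    (fun k => mul_nonneg k.cast_nonneg (watsonTerm_nonneg k)) (fun k => ?_) hg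
  · convert h using 1
    norm_num [invCentralBinom_succ, invCentralBinom_zero]
  · have hw : invCentralBinom (k + 1 + 2) = _ := invCentralBinom_succ (k + 2)
    simp only [hw, watsonTerm]
    push_cast
    rw [show (k : ℝ) + 1 + 2 = k + 3 by ring, show (k : ℝ) + 1 + 3 = k + 4 by ring]
    field_simp
    ring

theorem poch_zero (x : ℂ) : poch x 0 = 1 := by simp [poch]

theorem poch_succ (x : ℂ) (k : ℕ) : poch x (k + 1) = poch x k * (x + k) :=
  ascPochhammer_succ_eval k x

theorem poch_ne_zero {x : ℂ} (hx : 0 < x.re) (k : ℕ) : poch x k ≠ 0 := by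
  induction k with
  | zero => simp [poch_zero]
  | succ k ih =>
    rw [poch_succ]
    refine mul_ne_zero ih fun h => ?_
    have := congrArg Complex.re h
    simp at this
    linarith [(Nat.cast_nonneg k : (0 : ℝ) ≤ k)]

theorem mul_poch_add_one (x : ℂ) (k : ℕ) : x * poch (x + 1) k = poch x k * (x + k) := by
  induction k with
  | zero => simp [poch_zero]
  | succ k ih =>
    rw [poch_succ, poch_succ]
    push_cast
    linear_combination (x + 1 + k) * ih

theorem poch_one (k : ℕ) : poch 1 k = (k ! : ℂ) := by
  induction k with
  | zero => simp [poch_zero]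
  | succ k ih =>
    rw [poch_succ, ih, Nat.factorial_succ]
    push_cast
    ring

theorem poch_two (k : ℕ) : poch 2 k = (k ! : ℂ) * (k + 1) := by
  have h := mul_poch_add_one 1 k
  rw [poch_one, one_add_one_eq_two] at h
  linear_combination h

theorem poch_three (k : ℕ) : poch 3 k = (k ! : ℂ) * (k + 1) * (k + 2) / 2 := by
  have h := mul_poch_add_one 2 k
  rw [poch_two, two_add_one_eq_three] at h
  linear_combination h / 2

theorem poch_five (k : ℕ) :
    poch 5 k = (k ! : ℂ) * (k + 1) * (k + 2) * (k + 3) * (k + 4) / 24 := by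
  have h := mul_poch_add_one 3 k
  have h' := mul_poch_add_one 4 k
  rw [poch_three, three_add_one_eq_four] at h
  rw [show (4 : ℂ) + 1 = 5 by norm_num] at h'
  linear_combination h' / 4 + (k + 4) / 12 * h

theorem poch_five_halves_mul (k : ℕ) :
    poch (5 / 2) k * (invCentralBinom (k + 2) : ℂ) =
      4 / 3 * ((k ! : ℂ) * (k + 1) * (k + 2)) := by
  induction k with
  | zero => norm_num [poch_zero, invCentralBinom_succ, invCentralBinom_zero]
  | succ k ih =>
    have hw : invCentralBinom (k + 1 + 2) = _ := invCentralBinom_succ (k + 2)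
    have h : (2 * ((k : ℂ) + 2) + 1) ≠ 0 := by
      norm_cast
    rw [poch_succ, hw, Nat.factorial_succ]
    push_cast
    calc _ = poch (5 / 2) k * (invCentralBinom (k + 2) : ℂ) * (k + 3) := by field_simp; ring
      _ = _ := by rw [ih]; ring

theorem hyp_term_eq {d : ℂ} (hd : 0 < d.re) (k : ℕ) :
    ((([3, 1, 2, d + 1] : List ℂ).map (poch · k)).prod /
      (([5/2, 5, d] : List ℂ).map (poch · k)).prod) * 1 ^ k / (k ! : ℂ) =
    (watsonTerm k : ℂ) + ((k * watsonTerm k : ℝ) : ℂ) / d := by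
  have hd₀ : d ≠ 0 := by rintro rfl; simp at hd
  have hdk := poch_ne_zero hd k
  have h52 : poch (5 / 2) k ≠ 0 := poch_ne_zero (by norm_num) k
  have hf : (k ! : ℂ) ≠ 0 := by exact_mod_cast k.factorial_ne_zero
  have h₁ : (k : ℂ) + 1 ≠ 0 := by norm_cast
  have h₂ : (k : ℂ) + 2 ≠ 0 := by norm_cast
  have h₃ : (k : ℂ) + 3 ≠ 0 := by norm_cast
  have h₄ : (k : ℂ) + 4 ≠ 0 := by norm_cast
  have hp : poch (d + 1) k = poch d k * (d + k) / d := by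
    rw [← mul_poch_add_one]; field_simp
  have hw : (invCentralBinom (k + 2) : ℂ) =
      4 / 3 * ((k ! : ℂ) * (k + 1) * (k + 2)) / poch (5 / 2) k := by
    rw [← poch_five_halves_mul]; field_simp
  simp only [List.map_cons, List.map_nil, List.prod_cons, List.prod_nil, watsonTerm, hp,
    poch_one, poch_two, poch_three, poch_five]
  push_cast
  rw [hw]
  field_simp
  ring

theorem watson_m1_n0_s0 (d : ℂ) (hd : 0 < d.re) :
    hyp [3, 1, 2, d + 1] [5/2, 5, d] 1 =
      9 * (Real.pi : ℂ) ^ 2 / 16 + 3 * (4 / d - 1) := by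
  unfold hyp
  simp_rw [hyp_term_eq hd]
  have h := (Complex.hasSum_ofReal.2 hasSum_watsonTerm).add
    ((Complex.hasSum_ofReal.2 hasSum_mul_watsonTerm).div_const d)
  rw [h.tsum_eq]
  push_cast
  ring
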